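/- arXiv:1409.0952 — 8 statements merged into one kernel-verified Lean document; each statement's English description precedes it below -/
import Mathlib

section
/- Let C be an [n,k] locally repairable code with locality r over F_q. Then there exists an (r+1)-cover S = {S_1,…,S_t} over [n] with t ≥ n_1 such that for every integer x with 1 ≤ x ≤ n_1, Φ(x) ≤ min{|∪_{i∈J} S_i| : J ⊆ [t], |J| = x}. -/
open Finset Matrix

/-- `R` is a regenerating set of the `i`-th coordinate. -/
def RegSet {F : Type*} [Field F] {k n : ℕ} (g : Fin n → Fin k → F)
    (i : Fin n) (R : Finset (Fin n)) : Prop :=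
  i ∈ R ∧ g i ∈ Submodule.span F (g '' ((R.erase i : Finset (Fin n)) : Set (Fin n)))

/-- The sequence of regenerating sets `R 1, …, R m` has a nontrivial union. -/
def NTU {F : Type*} [Field F] {k n : ℕ} (g : Fin n → Fin k → F) {m : ℕ}
    (R : Fin m → Finset (Fin n)) (l : Fin m → Fin n) : Prop :=
  (∀ j, RegSet g (l j) (R j)) ∧ ∀ j i : Fin m, i < j → l j ∉ R i

/-- `S 1, …, S t` is an `(r+1)`-cover over `[n]`. -/
def IsCover (n r t : ℕ) (S : Fin t → Finset (Fin n)) : Prop :=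
  (∀ i, (S i).card = r + 1) ∧
  Finset.univ.biUnion S = (Finset.univ : Finset (Fin n)) ∧
  ∀ j : Fin t, (Finset.univ.erase j).biUnion S ≠ (Finset.univ : Finset (Fin n))

/-- Processing the elements of `Fin n` in increasing order and keeping those not covered so far
selects a cover from any family `R` with `i ∈ R i`. -/
lemma exists_cover_notMem_of_lt {n : ℕ} (R : Fin n → Finset (Fin n)) (hR : ∀ i, i ∈ R i) :
    ∃ A : Finset (Fin n), A.biUnion R = Finset.univ ∧
      ∀ a ∈ A, ∀ b ∈ A, a < b → b ∉ R a := by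
  have key : ∀ m : ℕ, ∃ A : Finset (Fin n), (∀ a ∈ A, a.val < m) ∧
      (∀ i : Fin n, i.val < m → i ∈ A.biUnion R) ∧
      ∀ a ∈ A, ∀ b ∈ A, a < b → b ∉ R a := by
    intro m
    induction m with
    | zero => exact ⟨∅, by simp, by simp, by simp⟩
    | succ m ih =>
      obtain ⟨A, hlt, hcov, hA⟩ := ih
      by_cases h : ∀ i : Fin n, i.val = m → i ∈ A.biUnion R
      · refine ⟨A, fun a ha => (hlt a ha).trans m.lt_succ_self, fun i hi => ?_, hA⟩
        rcases Nat.lt_succ_iff_lt_or_eq.mp hi with hi | hi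
        · exact hcov i hi
        · exact h i hi
      · push Not at h
        obtain ⟨c, rfl, hc⟩ := h
        have hc' : ∀ a ∈ A, c ∉ R a := by simpa using hc
        refine ⟨insert c A, ?_, fun i hi => ?_, ?_⟩
        · intro a ha
          rcases Finset.mem_insert.mp ha with rfl | ha
          · exact Nat.lt_succ_self _
          · exact (hlt a ha).trans (Nat.lt_succ_self _)
        · rw [Finset.biUnion_insert, Finset.mem_union]
          rcases Nat.lt_succ_iff_lt_or_eq.mp hi with hi | hi
          · exact Or.inr (hcov i hi)
          · exact Or.inl (Fin.ext hi ▸ hR i)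
        · intro a ha b hb hab
          rcases Finset.mem_insert.mp ha with rfl | haA
          · rcases Finset.mem_insert.mp hb with rfl | hb
            · exact absurd hab (lt_irrefl _)
            · exact absurd (hlt b hb) (not_lt.mpr (Fin.lt_def.mp hab).le)
          · rcases Finset.mem_insert.mp hb with rfl | hb
            · exact hc' a haA
            · exact hA a haA b hb hab
  obtain ⟨A, -, hcov, hA⟩ := key n
  exact ⟨A, Finset.eq_univ_of_forall fun i => hcov i i.isLt, hA⟩

/-- Every cover contains an irredundant subcover. -/
lemma exists_irredundant_subcover {ι α : Type*} [DecidableEq ι] [Fintype α] [DecidableEq α]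
    (S : ι → Finset α) (A : Finset ι) (hA : A.biUnion S = Finset.univ) :
    ∃ B ⊆ A, B.biUnion S = Finset.univ ∧ ∀ b ∈ B, (B.erase b).biUnion S ≠ Finset.univ := by
  induction A using Finset.strongInduction with
  | H A ih =>
    by_cases h : ∀ b ∈ A, (A.erase b).biUnion S ≠ Finset.univ
    · exact ⟨A, Finset.Subset.refl _, hA, h⟩
    · push Not at h
      obtain ⟨b, hb, hcov⟩ := h
      obtain ⟨B, hB, hB'⟩ := ih _ (Finset.erase_ssubset hb) hcov
      exact ⟨B, hB.trans (Finset.erase_subset _ _), hB'⟩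

/-- An `[n,k]` locally repairable code with locality `r` induces an
`(r+1)`-cover `S = {S_1,…,S_t}` over `[n]` with `t ≥ n₁ = ⌈n/(r+1)⌉` such that for every
`1 ≤ x ≤ n₁`, `Φ(x) ≤ min{|∪_{i∈J} S_i| : J ⊆ [t], |J| = x}` (expressed via the existence,
for each such `J`, of a sequence of `x` regenerating sets with nontrivial union whose union
has size at most `|∪_{i∈J} S_i|`). -/
theorem LRC_induces_cover
    {F : Type*} [Field F] [Fintype F] [DecidableEq F]
    {n k r : ℕ} (g : Fin n → Fin k → F)
    (hrank : Submodule.span F (Set.range g) = ⊤)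
    (hloc : ∀ i : Fin n, ∃ R : Finset (Fin n), RegSet g i R ∧ R.card ≤ r + 1)
    (hr1 : 1 < r) (hrk : r < k) (hrate : k * (r + 1) ≤ n * r) :
    ∃ (t : ℕ) (S : Fin t → Finset (Fin n)),
      (n + r) / (r + 1) ≤ t ∧ IsCover n r t S ∧
      ∀ x : ℕ, 1 ≤ x → x ≤ (n + r) / (r + 1) →
        ∀ J : Finset (Fin t), J.card = x →
          ∃ (R : Fin x → Finset (Fin n)) (l : Fin x → Fin n),
            NTU g R l ∧ (Finset.univ.biUnion R).card ≤ (J.biUnion S).card := by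
  have hn : r + 1 ≤ n := by
    by_contra! h
    nlinarith
  choose R hR hRcard using hloc
  obtain ⟨A, hAcov, hA⟩ := exists_cover_notMem_of_lt R fun i => (hR i).1
  choose T hRT hTcard using fun i =>
    Finset.exists_superset_card_eq (hRcard i) (by simpa using hn)
  have hATcov : A.biUnion T = Finset.univ :=
    Finset.univ_subset_iff.mp (hAcov ▸ Finset.biUnion_mono fun a _ => hRT a)
  obtain ⟨B, hBA, hBcov, hBmin⟩ := exists_irredundant_subcover T A hATcov
  let e := B.orderEmbOfFin rfl
  have himage : Finset.univ.image e = B := Finset.image_orderEmbOfFin_univ B rfl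
  have hunion (J : Finset (Fin B.card)) : J.biUnion (fun i => T (e i)) = (J.image e).biUnion T :=
    Finset.image_biUnion.symm
  have heB (i : Fin B.card) : e i ∈ B := B.orderEmbOfFin_mem rfl i
  refine ⟨B.card, fun i => T (e i), ?_, ⟨fun i => hTcard _, ?_, fun j => ?_⟩, ?_⟩
  · have hle : n ≤ B.card * (r + 1) := by
      simpa [hBcov] using Finset.card_biUnion_le_card_mul B T (r + 1) fun i _ => (hTcard i).le
    rw [← Nat.lt_succ_iff, Nat.div_lt_iff_lt_mul r.succ_pos, Nat.succ_mul]
    lia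
  · rw [hunion, himage, hBcov]
  · rw [hunion, Finset.image_erase e.injective, himage]
    exact hBmin _ (heB j)
  · rintro x - - J hJ
    let f := J.orderEmbOfFin hJ
    refine ⟨fun j => R (e (f j)), fun j => e (f j), ⟨fun j => hR _, fun j i hij => ?_⟩, ?_⟩
    · exact hA _ (hBA (heB _)) _ (hBA (heB _)) (e.strictMono (f.strictMono hij))
    · refine Finset.card_le_card (Finset.biUnion_subset.mpr fun j _ => (hRT _).trans ?_)
      exact Finset.subset_biUnion_of_mem (fun i => T (e i)) (J.orderEmbOfFin_mem hJ j)
end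

section
/- Let n and r be positive integers and let S = {S_1,…,S_t} be an (r+1)-cover over [n] with t > n_1. Then there exists an (r+1)-cover T = {T_1,…,T_{n_1}} over [n] consisting of exactly n_1 subsets such that for every integer x with 1 ≤ x ≤ n_1, min{|∪_{i∈J} S_i| : J ⊆ [t], |J| = x} ≤ min{|∪_{i∈I} T_i| : I ⊆ [n_1], |I| = x}. -/
open Finset

/-- Exchange step: an element lying in two members of a family may be replaced, in one of them,
by an uncovered element, without shrinking the union of any subfamily. -/
theorem exists_exchange {α ι : Type*} [DecidableEq α] [DecidableEq ι] [Fintype ι]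
    {k : ℕ} {S : ι → Finset α} (hcard : ∀ i, (S i).card = k)
    (hpriv : ∀ i, ∃ w ∈ S i, ∀ j, j ≠ i → w ∉ S j)
    {i j : ι} (hij : i ≠ j) {v w : α} (hvi : v ∈ S i) (hvj : v ∈ S j) (hw : ∀ l, w ∉ S l) :
    ∃ T : ι → Finset α, (∀ i, (T i).card = k) ∧
      (∀ i, ∃ w ∈ T i, ∀ j, j ≠ i → w ∉ T j) ∧
      univ.biUnion T = insert w (univ.biUnion S) ∧
      ∀ I : Finset ι, (I.biUnion S).card ≤ (I.biUnion T).card := by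
  have hmem : ∀ l x, x ∈ Function.update S i (insert w ((S i).erase v)) l ↔
      if l = i then x = w ∨ (x ≠ v ∧ x ∈ S i) else x ∈ S l := by
    intro l x
    by_cases h : l = i
    · subst h; simp
    · simp [h]
  refine ⟨Function.update S i (insert w ((S i).erase v)), fun l => ?_, fun l => ?_, ?_,
    fun I => ?_⟩
  · by_cases h : l = i
    · subst h
      rw [Function.update_self, card_insert_of_notMem (fun h => hw l (mem_of_mem_erase h)),
        card_erase_add_one hvi, hcard]
    · rw [Function.update_of_ne h, hcard]
  · by_cases h : l = i
    · subst h
      refine ⟨w, by simp, fun j hj => ?_⟩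
      rw [hmem, if_neg hj]
      exact hw j
    · obtain ⟨p, hp, hpl⟩ := hpriv l
      refine ⟨p, by rw [hmem, if_neg h]; exact hp, fun j hj => ?_⟩
      rw [hmem]
      split_ifs with hji
      · rintro (rfl | ⟨-, hpi⟩)
        · exact hw l hp
        · exact hpl i (Ne.symm h) hpi
      · exact hpl j hj
  · ext x
    simp only [mem_biUnion, mem_univ, true_and, mem_insert, hmem]
    constructor
    · rintro ⟨l, hl⟩
      split_ifs at hl with h
      · exact hl.imp id fun h => ⟨i, h.2⟩
      · exact Or.inr ⟨l, hl⟩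
    · rintro (rfl | ⟨l, hl⟩)
      · exact ⟨i, by simp⟩
      · by_cases hli : l = i
        · subst hli
          by_cases hxv : x = v
          · subst hxv
            exact ⟨j, by rw [if_neg hij.symm]; exact hvj⟩
          · exact ⟨l, by simp [hxv, hl]⟩
        · exact ⟨l, by rw [if_neg hli]; exact hl⟩
  · by_cases hi : i ∈ I
    · have hsub : insert w ((I.biUnion S).erase v) ⊆
          I.biUnion (Function.update S i (insert w ((S i).erase v))) := by
        intro x hx
        simp only [mem_insert, mem_erase, mem_biUnion] at hx
        simp only [mem_biUnion, hmem]
        obtain rfl | ⟨hxv, l, hl, hxl⟩ := hx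
        · exact ⟨i, hi, by simp⟩
        · refine ⟨l, hl, ?_⟩
          split_ifs with h
          · subst h
            exact Or.inr ⟨hxv, hxl⟩
          · exact hxl
      refine le_trans ?_ (card_le_card hsub)
      rw [card_insert_of_notMem (by simp [hw]),
        card_erase_add_one (mem_biUnion.2 ⟨i, hi, hvi⟩)]
    · refine (congrArg card (biUnion_congr rfl fun l hl => ?_)).le
      rw [Function.update_of_ne (ne_of_mem_of_not_mem hl hi)]

/-- A family of `k`-sets with private elements whose total size is at least that of the ground type
can be modified into a covering one without shrinking the union of any subfamily. -/
theorem exists_cover_of_private {α ι : Type*} [DecidableEq α] [Fintype α] [DecidableEq ι]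
    [Fintype ι] {k : ℕ} (hk : Fintype.card α ≤ Fintype.card ι * k) (S : ι → Finset α)
    (hcard : ∀ i, (S i).card = k) (hpriv : ∀ i, ∃ w ∈ S i, ∀ j, j ≠ i → w ∉ S j) :
    ∃ T : ι → Finset α, (∀ i, (T i).card = k) ∧
      (∀ i, ∃ w ∈ T i, ∀ j, j ≠ i → w ∉ T j) ∧
      univ.biUnion T = univ ∧
      ∀ I : Finset ι, (I.biUnion S).card ≤ (I.biUnion T).card := by
  induction hd : ((univ.biUnion S)ᶜ).card generalizing S with
  | zero =>
    refine ⟨S, hcard, hpriv, ?_, fun _ => le_rfl⟩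
    simpa using hd
  | succ d ih =>
    obtain ⟨w, hw⟩ : ((univ.biUnion S)ᶜ).Nonempty := card_pos.1 (by omega)
    have hwS : ∀ l, w ∉ S l := by simpa using hw
    obtain ⟨i, j, hij, v, hvi, hvj⟩ : ∃ i j, i ≠ j ∧ ∃ v, v ∈ S i ∧ v ∈ S j := by
      by_contra! h
      have hdisj : (univ.biUnion S).card = ∑ i, (S i).card :=
        card_biUnion fun i _ j _ hij => disjoint_left.2 fun v hi hj => h i j hij v hi hj
      simp only [hcard, sum_const, smul_eq_mul, card_univ] at hdisj
      have := card_add_card_compl (univ.biUnion S)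
      omega
    obtain ⟨T, hT, hTp, hTu, hST⟩ := exists_exchange hcard hpriv hij hvi hvj hwS
    obtain ⟨U, hU, hUp, hUu, hTU⟩ := ih T hT hTp (by
      rw [hTu, compl_insert, card_erase_of_mem hw, hd, Nat.add_sub_cancel])
    exact ⟨U, hU, hUp, hUu, fun I => (hST I).trans (hTU I)⟩

/-- From any `(r+1)`-cover `S = {S_1,…,S_t}` over `[n]` with
`t > n₁ = ⌈n/(r+1)⌉` one gets an `(r+1)`-cover `T = {T_1,…,T_{n₁}}` with exactly `n₁`
subsets such that for every `1 ≤ x ≤ n₁`,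
`min{|∪_{i∈J} S_i| : |J| = x} ≤ min{|∪_{i∈I} T_i| : |I| = x}` (expressed as: for every `I`
of size `x` there is a `J` of size `x` with `|∪_{i∈J} S_i| ≤ |∪_{i∈I} T_i|`). -/
theorem cover_reduction
    {n r t : ℕ} (hn : 0 < n) (hr : 0 < r)
    (S : Fin t → Finset (Fin n)) (hS : IsCover n r t S)
    (ht : (n + r) / (r + 1) < t) :
    ∃ T : Fin ((n + r) / (r + 1)) → Finset (Fin n),
      IsCover n r ((n + r) / (r + 1)) T ∧
      ∀ x : ℕ, 1 ≤ x → x ≤ (n + r) / (r + 1) →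
        ∀ I : Finset (Fin ((n + r) / (r + 1))), I.card = x →
          ∃ J : Finset (Fin t), J.card = x ∧ (J.biUnion S).card ≤ (I.biUnion T).card := by
  obtain ⟨hcard, hcov, hmin⟩ := hS
  have hpriv : ∀ i, ∃ w ∈ S i, ∀ j, j ≠ i → w ∉ S j := by
    intro i
    obtain ⟨w, hw⟩ : ∃ w, w ∉ (univ.erase i).biUnion S := by
      by_contra! h
      exact hmin i (eq_univ_iff_forall.2 h)
    have hwj : ∀ j, j ≠ i → w ∉ S j := by simpa using hw
    obtain ⟨l, -, hl⟩ := mem_biUnion.1 (hcov ▸ mem_univ w)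
    obtain rfl : l = i := by
      by_contra h
      exact hwj l h hl
    exact ⟨w, hl, hwj⟩
  have hbound : n ≤ (n + r) / (r + 1) * (r + 1) := by
    have := Nat.div_add_mod (n + r) (r + 1)
    have : (n + r) % (r + 1) < r + 1 := Nat.mod_lt _ r.succ_pos
    rw [mul_comm]
    omega
  let e := Fin.castLEEmb ht.le
  obtain ⟨T, hT, hTp, hTu, hST⟩ := exists_cover_of_private (k := r + 1) (by simpa using hbound)
    (fun i => S (e i)) (fun i => hcard _) fun i => by
      obtain ⟨w, hw, hwj⟩ := hpriv (e i)
      exact ⟨w, hw, fun j hj => hwj _ (e.injective.ne hj)⟩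
  refine ⟨T, ⟨hT, hTu, fun j hj => ?_⟩, fun x _ _ I hI => ⟨I.map e, by simpa using hI, ?_⟩⟩
  · obtain ⟨w, -, hw⟩ := hTp j
    obtain ⟨l, hl, hwl⟩ := mem_biUnion.1 (hj ▸ mem_univ w)
    exact hw l (ne_of_mem_erase hl) hwl
  · rw [map_eq_image, image_biUnion]
    exact hST I
end

section
/- Let S = {S_1,…,S_{n_1}} be an (r+1)-cover over [n], and let [n_1] = I_1 ∪ ⋯ ∪ I_s be a partition such that for each h ∈ [s] the collection {S_j : j ∈ I_h} is connected, and for h ≠ h' the sets ∪_{j∈I_h} S_j and ∪_{j∈I_{h'}} S_j are disjoint. Set t_h = |I_h| and a_h = Σ_{j∈I_h} |S_j| − |∪_{j∈I_h} S_j| for h ∈ [s]. Then for every integer x with 1 ≤ x ≤ n_1, min{|∪_{i∈I} S_i| : I ⊆ [n_1], |I| = x} is at most the minimum, over all integers l ≥ 1 and distinct indices h_1,…,h_l ∈ [s] satisfying t_{h_1}+⋯+t_{h_{l−1}} < x ≤ t_{h_1}+⋯+t_{h_l}, of xr + 1 − Σ_{i=1}^{l−1}(a_{h_i} − t_{h_i}).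 -/
open Finset

/-- The subcollection `{S j : j ∈ I}` is connected. -/
def ConnectedOn {n m : ℕ} (S : Fin m → Finset (Fin n)) (I : Finset (Fin m)) : Prop :=
  ∀ J ⊆ I, J.Nonempty → J ≠ I → ((J.biUnion S) ∩ ((I \ J).biUnion S)).Nonempty

/-- A connected collection of sets of size `r + 1` has subcollections of every positive size `y`
whose union has at most `y * r + 1` elements. -/
theorem ConnectedOn.exists_subset_card_biUnion_le {n m r : ℕ} {S : Fin m → Finset (Fin n)}
    {I : Finset (Fin m)} (hconn : ConnectedOn S I) (hS : ∀ i ∈ I, (S i).card = r + 1)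
    (y : ℕ) (hy : y + 1 ≤ I.card) :
    ∃ J ⊆ I, J.card = y + 1 ∧ (J.biUnion S).card ≤ (y + 1) * r + 1 := by
  induction y with
  | zero =>
    obtain ⟨j, hj⟩ := Finset.card_pos.mp (by omega : 0 < I.card)
    exact ⟨{j}, by simpa using hj, by simp, by simp [hS j hj]⟩
  | succ y ih =>
    obtain ⟨J, hJI, hJ, hJS⟩ := ih (by omega)
    obtain ⟨a, ha⟩ := hconn J hJI (Finset.card_pos.mp (by omega)) (by rintro rfl; omega)
    obtain ⟨haJ, haI⟩ := Finset.mem_inter.mp ha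
    obtain ⟨j, hj, haj⟩ := Finset.mem_biUnion.mp haI
    obtain ⟨hjI, hjJ⟩ := Finset.mem_sdiff.mp hj
    refine ⟨insert j J, Finset.insert_subset hjI hJI, by rw [Finset.card_insert_of_notMem hjJ, hJ],
      ?_⟩
    have hpos : 0 < (S j ∩ J.biUnion S).card :=
      Finset.card_pos.mpr ⟨a, Finset.mem_inter.mpr ⟨haj, haJ⟩⟩
    have hcard := Finset.card_union_add_card_inter (S j) (J.biUnion S)
    rw [Finset.biUnion_insert]
    rw [hS j hjI] at hcard
    have : (y + 1 + 1) * r = (y + 1) * r + r := by ring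
    omega

/-- Let `S = {S_1,…,S_{n₁}}` be an `(r+1)`-cover over `[n]`,
`[n₁] = I_1 ∪ ⋯ ∪ I_s` a partition into nonempty parts with each `{S_j : j ∈ I_h}`
connected and the unions `∪_{j∈I_h} S_j` pairwise disjoint; set `t_h = |I_h|` and
`a_h = Σ_{j∈I_h}|S_j| − |∪_{j∈I_h} S_j|`.  Then for `1 ≤ x ≤ n₁` and any distinct indices
`h_1,…,h_l` (here `h : Fin (l+1) → Fin s` injective, of length `l+1 ≥ 1`) with
`t_{h_1}+⋯+t_{h_{l−1}} < x ≤ t_{h_1}+⋯+t_{h_l}`, there is an `I ⊆ [n₁]` with `|I| = x` and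
`|∪_{i∈I} S_i| ≤ xr + 1 − Σ_{i=1}^{l−1}(a_{h_i} − t_{h_i})`; that is, the min over `I` is at
most the min over all such `(l, h)` of this expression. -/
theorem cover_partition_union_bound
    {n r n1 s : ℕ} (hn : 0 < n) (hr : 0 < r)
    (hn1 : n1 = (n + r) / (r + 1))
    (S : Fin n1 → Finset (Fin n)) (hS : IsCover n r n1 S)
    (I : Fin s → Finset (Fin n1))
    (hne : ∀ h, (I h).Nonempty)
    (hcover : Finset.univ.biUnion I = (Finset.univ : Finset (Fin n1)))
    (hconn : ∀ h, ConnectedOn S (I h))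
    (hdisj : ∀ h h' : Fin s, h ≠ h' →
      Disjoint ((I h).biUnion S) ((I h').biUnion S)) :
    ∀ x : ℕ, 1 ≤ x → x ≤ n1 →
      ∀ (l : ℕ) (h : Fin (l + 1) → Fin s), Function.Injective h →
        (∑ i : Fin l, (I (h i.castSucc)).card) < x →
        x ≤ (∑ i : Fin (l + 1), (I (h i)).card) →
        ∃ Js : Finset (Fin n1), Js.card = x ∧
          ((Js.biUnion S).card : ℤ) ≤ (x : ℤ) * r + 1 -
            ∑ i : Fin l,
              ((((∑ j ∈ I (h i.castSucc), (S j).card)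
                  - ((I (h i.castSucc)).biUnion S).card : ℕ) : ℤ)
                - ((I (h i.castSucc)).card : ℤ)) := by
  intro x _ _ l h hinj hlt hle
  obtain ⟨hcard, -, -⟩ := hS
  have hI : ∀ p q : Fin s, p ≠ q → Disjoint (I p) (I q) := by
    intro p q hpq
    rw [Finset.disjoint_left]
    intro j hp hq
    obtain ⟨a, ha⟩ := Finset.card_pos.mp (by rw [hcard j]; omega : 0 < (S j).card)
    exact Finset.disjoint_left.mp (hdisj p q hpq)
      (Finset.mem_biUnion.mpr ⟨j, hp, ha⟩) (Finset.mem_biUnion.mpr ⟨j, hq, ha⟩)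
  rw [Fin.sum_univ_castSucc] at hle
  obtain ⟨y, rfl⟩ := Nat.exists_eq_add_of_lt hlt
  obtain ⟨J, hJI, hJ, hJS⟩ := (hconn (h (Fin.last l))).exists_subset_card_biUnion_le
    (fun i _ => hcard i) y (by omega)
  set F : Finset (Fin n1) := Finset.univ.biUnion fun i : Fin l => I (h i.castSucc) with hF
  have hFcard : F.card = ∑ i : Fin l, (I (h i.castSucc)).card :=
    Finset.card_biUnion fun i _ k _ hik =>
      hI _ _ fun e => hik (Fin.castSucc_injective l (hinj e))
  have hFJ : Disjoint F J := by
    rw [hF, Finset.disjoint_biUnion_left]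
    exact fun i _ => (hI _ _ fun e => Fin.castSucc_ne_last i (hinj e)).mono_right hJI
  refine ⟨F ∪ J, by rw [Finset.card_union_of_disjoint hFJ, hFcard, hJ]; omega, ?_⟩
  have hFS : (F.biUnion S).card ≤ ∑ i : Fin l, ((I (h i.castSucc)).biUnion S).card := by
    rw [hF, Finset.biUnion_biUnion]
    exact Finset.card_biUnion_le
  have hU : ((F ∪ J).biUnion S).card ≤ (F.biUnion S).card + (J.biUnion S).card := by
    rw [Finset.union_biUnion]
    exact Finset.card_union_le _ _
  have hdefect : ∑ i : Fin l,
      ((((∑ j ∈ I (h i.castSucc), (S j).card)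
          - ((I (h i.castSucc)).biUnion S).card : ℕ) : ℤ) - ((I (h i.castSucc)).card : ℤ))
      = (∑ i : Fin l, ((I (h i.castSucc)).card : ℤ)) * r
        - ∑ i : Fin l, (((I (h i.castSucc)).biUnion S).card : ℤ) := by
    rw [Finset.sum_mul, ← Finset.sum_sub_distrib]
    refine Finset.sum_congr rfl fun i _ => ?_
    rw [Nat.cast_sub Finset.card_biUnion_le, Finset.sum_congr rfl fun j _ => hcard j,
      Finset.sum_const, smul_eq_mul]
    push_cast
    ring
  rw [hdefect]
  zify at hFS hU hJS
  push_cast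
  linarith
end

section
/- Let n and r be positive integers with n_1 > n_2. Then for every integer x with 1 ≤ x ≤ n_1, Ψ(x) ≥ xr + max{⌈x/(λ+1)⌉, ⌈(x−ν)/λ⌉}. -/
open Finset

/-- Feasibility constraints of the outer ("Max") part of the integer program defining `Ψ`. -/
def OuterFeas (n1 n2 s : ℕ) (t a : Fin s → ℕ) : Prop :=
  1 ≤ s ∧ (∀ i, 1 ≤ t i) ∧ (∑ i, t i) = n1 ∧ (∑ i, a i) = n2 ∧ ∀ i, t i ≤ a i + 1

/-- Feasibility constraints of the inner ("Min") part of the integer program defining `Ψ`. -/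
def InnerFeas {s : ℕ} (t : Fin s → ℕ) (x l : ℕ) (h : Fin (l + 1) → Fin s) : Prop :=
  Function.Injective h ∧ (∑ i : Fin l, t (h i.castSucc)) < x ∧
    x ≤ ∑ i : Fin (l + 1), t (h i)

/-- The objective value `xr + 1 − Σ_{i=1}^{l}(a_{h_i} − t_{h_i})` of the integer program. -/
def IPVal {s : ℕ} (t a : Fin s → ℕ) (x r l : ℕ) (h : Fin (l + 1) → Fin s) : ℤ :=
  (x : ℤ) * r + 1 - ∑ i : Fin l, ((a (h i.castSucc) : ℤ) - (t (h i.castSucc) : ℤ))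

theorem sum_fin_ite_val_lt {m k : ℕ} (h : k ≤ m) :
    ∑ i : Fin m, (if (i : ℕ) < k then 1 else 0) = k := by
  rw [Fin.sum_univ_eq_sum_range (fun i => if i < k then 1 else 0) m, ← Finset.sum_filter,
    Finset.sum_const, smul_eq_mul, mul_one]
  have : (Finset.range m).filter (· < k) = Finset.range k := by
    ext i
    simp only [Finset.mem_filter, Finset.mem_range]
    omega
  rw [this, Finset.card_range]

/-- Let `n, r` be positive with `n₁ > n₂`, where `n₁ = ⌈n/(r+1)⌉`,
`n₂ = n₁(r+1) − n`, `μ = n₁ − n₂`, `n₁ = λμ + ν` with `0 ≤ ν < μ`.  Then for every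
`1 ≤ x ≤ n₁`, `Ψ(x) ≥ xr + max{⌈x/(λ+1)⌉, ⌈(x−ν)/λ⌉}`: there is an outer-feasible datum
such that every inner-feasible datum has objective value at least this quantity. -/
theorem Psi_lower_bound
    {n r n1 n2 mu lam nu : ℕ} (hn : 0 < n) (hr : 0 < r)
    (hn1 : n1 = (n + r) / (r + 1)) (hn2 : n2 = n1 * (r + 1) - n)
    (h12 : n2 < n1) (hmu : mu = n1 - n2)
    (hlamnu : n1 = lam * mu + nu) (hnu : nu < mu) :
    ∀ x : ℕ, 1 ≤ x → x ≤ n1 →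
      ∃ (s : ℕ) (t a : Fin s → ℕ), OuterFeas n1 n2 s t a ∧
        ∀ (l : ℕ) (h : Fin (l + 1) → Fin s), InnerFeas t x l h →
          (x : ℤ) * r + max ⌈(x : ℚ) / ((lam : ℚ) + 1)⌉ ⌈((x : ℚ) - (nu : ℚ)) / (lam : ℚ)⌉
            ≤ IPVal t a x r l h := by
  intro x _ _
  have hmu_pos : 0 < mu := by omega
  have hmu_le : mu ≤ n1 := by omega
  have hlam : 1 ≤ lam := by
    rcases Nat.eq_zero_or_pos lam with h0 | h0
    · subst h0
      omega
    · exact h0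
  have hind := sum_fin_ite_val_lt hnu.le
  set e : Fin mu → ℕ := fun i => if (i : ℕ) < nu then 1 else 0 with he
  have he_le : ∀ i, e i ≤ 1 := by
    intro i
    simp only [he]
    split_ifs <;> omega
  have ht : ∑ i, (lam + e i) = n1 := by
    rw [Finset.sum_add_distrib, hind, Finset.sum_const, Finset.card_univ, Fintype.card_fin,
      smul_eq_mul, hlamnu, mul_comm]
  refine ⟨mu, fun i => lam + e i, fun i => lam + e i - 1,
    ⟨hmu_pos, fun i => by dsimp only; omega, ht, ?_, fun i => by dsimp only; omega⟩, ?_⟩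
  · have hsum : ∑ i, (lam + e i - 1) + mu = n1 := by
      calc ∑ i, (lam + e i - 1) + mu = ∑ i : Fin mu, ((lam + e i - 1) + 1) := by
            simp [Finset.sum_add_distrib]
        _ = ∑ i, (lam + e i) := Finset.sum_congr rfl fun i _ => by omega
        _ = n1 := ht
    dsimp only
    omega
  · rintro l h ⟨hinj, -, hx⟩
    have hval : IPVal (fun i => lam + e i) (fun i => lam + e i - 1) x r l h
        = (x : ℤ) * r + (l + 1) := by
      have hterm : ∀ i : Fin l, (((lam + e (h i.castSucc) - 1 : ℕ) : ℤ)
          - ((lam + e (h i.castSucc) : ℕ) : ℤ)) = -1 := fun i => by omega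
      simp only [IPVal, hterm, Finset.sum_const, Finset.card_univ, Fintype.card_fin]
      simp
      ring
    rw [hval]
    have hx' : x ≤ (l + 1) * lam + ∑ i, e (h i) := by
      simpa [Finset.sum_add_distrib] using hx
    have hcard : ∑ i, e (h i) ≤ l + 1 := by
      simpa using Finset.sum_le_sum fun i (_ : i ∈ Finset.univ) => he_le (h i)
    have hle_nu : ∑ i, e (h i) ≤ nu := by
      calc ∑ i, e (h i) = ∑ j ∈ Finset.univ.map ⟨h, hinj⟩, e j := by simp
        _ ≤ ∑ j, e j := Finset.sum_le_sum_of_subset (Finset.subset_univ _)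
        _ = nu := hind
    have h1 : x ≤ (l + 1) * lam + (l + 1) := by omega
    have h2 : x ≤ (l + 1) * lam + nu := by omega
    have h1' : (x : ℚ) ≤ (l + 1) * lam + (l + 1) := by exact_mod_cast h1
    have h2' : (x : ℚ) ≤ (l + 1) * lam + nu := by exact_mod_cast h2
    have hlam' : (0 : ℚ) < lam := by exact_mod_cast hlam
    refine add_le_add le_rfl (max_le ?_ ?_)
    · rw [Int.ceil_le, div_le_iff₀ (by positivity)]
      push_cast
      linarith
    · rw [Int.ceil_le, div_le_iff₀ hlam']
      push_cast
      linarith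
end

section
/- Let n and r be positive integers with n_1 > n_2. Then for every integer x with 1 ≤ x ≤ n_1, Ψ(x) ≤ xr + max{⌈x/(λ+1)⌉, ⌈(x−ν)/λ⌉}. -/
open Finset

/-- Between a set of weight less than `x` and a superset of weight at least `x` one can find a set
of weight less than `x` and one more element whose insertion reaches `x`. -/
theorem exists_insert_crossing {ι : Type*} [DecidableEq ι] (t : ι → ℕ) {x : ℕ} {N S : Finset ι}
    (hNS : N ⊆ S) (hN : ∑ i ∈ N, t i < x) (hS : x ≤ ∑ i ∈ S, t i) :
    ∃ (L : Finset ι) (e : ι), N ⊆ L ∧ e ∉ L ∧ insert e L ⊆ S ∧ ∑ i ∈ L, t i < x ∧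
      x ≤ ∑ i ∈ insert e L, t i := by
  obtain ⟨L, hL, hmax⟩ := Finset.exists_max_image
    (S.powerset.filter fun L => N ⊆ L ∧ ∑ i ∈ L, t i < x) Finset.card
    ⟨N, by simp [hNS, hN]⟩
  simp only [Finset.mem_filter, Finset.mem_powerset] at hL hmax
  obtain ⟨hLS, hNL, hLx⟩ := hL
  obtain ⟨e, heS, heL⟩ : ∃ e ∈ S, e ∉ L := by
    by_contra! hc
    rw [Finset.Subset.antisymm hLS hc] at hLx
    omega
  have hins : insert e L ⊆ S := Finset.insert_subset heS hLS
  refine ⟨L, e, hNL, heL, hins, hLx, ?_⟩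
  by_contra! hlt
  have := hmax _ ⟨hins, hNL.trans (Finset.subset_insert e L), hlt⟩
  rw [Finset.card_insert_of_notMem heL] at this
  omega

/-- If the deficiencies `d i` are at most `1` and sum to `μ`, while the weights `t i` sum to
`λμ + ν`, then some set containing every index of nonpositive deficiency has total deficiency `m`
and weight at least `x`. -/
theorem exists_heavy_superset {ι : Type*} [Fintype ι] [DecidableEq ι] (t : ι → ℕ) (d : ι → ℤ)
    (hd : ∀ i, d i ≤ 1) {lam mu nu m x : ℕ} (hdsum : ∑ i, d i = mu)
    (htsum : ∑ i, t i = lam * mu + nu) (hm : m ≤ mu) (hx : x ≤ m * (lam + 1))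
    (hx' : x ≤ nu + lam * m) :
    ∃ S : Finset ι, (Finset.univ.filter fun i => d i ≤ 0) ⊆ S ∧ ∑ i ∈ S, d i = m ∧
      x ≤ ∑ i ∈ S, t i := by
  set N : Finset ι := Finset.univ.filter fun i => d i ≤ 0 with hNdef
  have hd1 : ∀ i ∈ Nᶜ, d i = 1 := by
    intro i hi
    have := hd i
    simp only [hNdef, Finset.mem_compl, Finset.mem_filter, Finset.mem_univ, true_and] at hi
    omega
  have hsumN : ∑ i ∈ N, d i ≤ 0 :=
    Finset.sum_nonpos fun i hi => (Finset.mem_filter.mp hi).2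
  have hcard : ∑ i ∈ N, d i + (Nᶜ.card : ℤ) = mu := by
    rw [← hdsum, ← Finset.sum_add_sum_compl N d, Finset.sum_congr rfl hd1]
    simp
  obtain ⟨K, hK⟩ : ∃ K : ℕ, (K : ℤ) = m - ∑ i ∈ N, d i :=
    ⟨(m - ∑ i ∈ N, d i).toNat, Int.toNat_of_nonneg (by omega)⟩
  have hdisj : ∀ B ⊆ Nᶜ, Disjoint N B := fun B hB =>
    (disjoint_compl_right (a := N)).mono_right hB
  have hdB : ∀ B ⊆ Nᶜ, B.card = K → ∑ i ∈ N ∪ B, d i = m := by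
    intro B hB hBK
    rw [Finset.sum_union (hdisj B hB), Finset.sum_congr rfl fun i hi => hd1 i (hB hi)]
    simp only [Finset.sum_const, nsmul_eq_mul, mul_one]
    omega
  set A : Finset ι := Nᶜ.filter fun i => lam + 1 ≤ t i with hAdef
  have hAN : A ⊆ Nᶜ := Finset.filter_subset _ _
  rcases le_total K A.card with h | h
  · obtain ⟨B, hBA, hBK⟩ := Finset.exists_subset_card_eq h
    refine ⟨N ∪ B, Finset.subset_union_left, hdB B (hBA.trans hAN) hBK, ?_⟩
    have h1 : K * (lam + 1) ≤ ∑ i ∈ B, t i := by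
      rw [← hBK, ← smul_eq_mul]
      exact Finset.card_nsmul_le_sum _ _ _ fun i hi => (Finset.mem_filter.mp (hBA hi)).2
    have h2 : m * (lam + 1) ≤ K * (lam + 1) := Nat.mul_le_mul_right _ (by omega)
    rw [Finset.sum_union (hdisj B (hBA.trans hAN))]
    omega
  · obtain ⟨B, hAB, hBN, hBK⟩ := Finset.exists_subsuperset_card_eq hAN h (by omega)
    refine ⟨N ∪ B, Finset.subset_union_left, hdB B hBN hBK, ?_⟩
    have h1 : ∑ i ∈ Nᶜ \ B, t i ≤ (Nᶜ \ B).card * lam := by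
      rw [← smul_eq_mul]
      refine Finset.sum_le_card_nsmul _ _ _ fun i hi => ?_
      rw [Finset.mem_sdiff] at hi
      by_contra! hlt
      exact hi.2 (hAB (Finset.mem_filter.mpr ⟨hi.1, hlt⟩))
    have h2 : (Nᶜ \ B).card = mu - m := by
      rw [Finset.card_sdiff_of_subset hBN]
      omega
    have h3 : (mu - m) * lam + lam * m = lam * mu := by
      rw [mul_comm, ← mul_add, Nat.sub_add_cancel hm]
    have h4 := Finset.sum_sdiff (f := t) hBN
    have h5 := Finset.sum_add_sum_compl N t
    rw [Finset.sum_union (hdisj B hBN)]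
    rw [h2] at h1
    omega

/-- Under the hypotheses of `exists_heavy_superset` with `1 ≤ x` and `1 ≤ m`, some set of weight
less than `x` and total deficiency less than `m` reaches weight `x` upon inserting one element. -/
theorem exists_crossing_of_deficiency_lt {ι : Type*} [Fintype ι] [DecidableEq ι] (t : ι → ℕ)
    (d : ι → ℤ) (hd : ∀ i, d i ≤ 1) {lam mu nu m x : ℕ} (hdsum : ∑ i, d i = mu)
    (htsum : ∑ i, t i = lam * mu + nu) (hm1 : 1 ≤ m) (hm : m ≤ mu) (hx1 : 1 ≤ x)
    (hx : x ≤ m * (lam + 1)) (hx' : x ≤ nu + lam * m) :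
    ∃ (L : Finset ι) (e : ι), e ∉ L ∧ ∑ i ∈ L, t i < x ∧ x ≤ ∑ i ∈ insert e L, t i ∧
      ∑ i ∈ L, d i < m := by
  obtain ⟨S, hNS, hSd, hSx⟩ := exists_heavy_superset t d hd hdsum htsum hm hx hx'
  set N : Finset ι := Finset.univ.filter fun i => d i ≤ 0 with hNdef
  rcases le_or_gt x (∑ i ∈ N, t i) with h | h
  · obtain ⟨L, e, -, heL, hLN, hLx, hxL⟩ :=
      exists_insert_crossing t (Finset.empty_subset N) (by rwa [Finset.sum_empty]) h
    refine ⟨L, e, heL, hLx, hxL, ?_⟩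
    have : ∑ i ∈ L, d i ≤ 0 := Finset.sum_nonpos fun i hi =>
      (Finset.mem_filter.mp (hLN (Finset.mem_insert_of_mem hi))).2
    omega
  · obtain ⟨L, e, hNL, heL, hLS, hLx, hxL⟩ := exists_insert_crossing t hNS h hSx
    refine ⟨L, e, heL, hLx, hxL, ?_⟩
    have hpos : ∀ i, i ∉ L → 0 < d i := by
      intro i hi
      by_contra! hle
      exact hi (hNL (Finset.mem_filter.mpr ⟨Finset.mem_univ i, hle⟩))
    rw [← hSd]
    exact Finset.sum_lt_sum_of_subset ((Finset.subset_insert e L).trans hLS)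
      (hLS (Finset.mem_insert_self e L)) heL (hpos e heL) fun j _ hj => (hpos j hj).le

/-- A set together with one further element yields an inner-feasible enumeration. -/
theorem exists_innerFeas_of_insert {s : ℕ} (t a : Fin s → ℕ) (x r : ℕ) {L : Finset (Fin s)}
    {e : Fin s} (heL : e ∉ L) (hL : ∑ i ∈ L, t i < x) (hx : x ≤ ∑ i ∈ insert e L, t i) :
    ∃ (l : ℕ) (h : Fin (l + 1) → Fin s), InnerFeas t x l h ∧
      IPVal t a x r l h = (x : ℤ) * r + 1 + ∑ i ∈ L, ((t i : ℤ) - (a i : ℤ)) := by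
  have hsum : ∀ {M : Type} [AddCommMonoid M] (f : Fin s → M),
      ∑ i : Fin L.card, f (L.equivFin.symm i) = ∑ i ∈ L, f i := by
    intro M _ f
    rw [← Finset.sum_coe_sort L f]
    exact Equiv.sum_comp L.equivFin.symm fun i : L => f i
  refine ⟨L.card, Fin.snoc (α := fun _ => Fin s) (fun i => (L.equivFin.symm i : Fin s)) e,
    ⟨?_, ?_, ?_⟩, ?_⟩
  · rw [Fin.snoc_injective_iff]
    refine ⟨Subtype.val_injective.comp L.equivFin.symm.injective, ?_⟩
    rintro ⟨i, rfl⟩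
    exact heL (L.equivFin.symm i).2
  · simpa only [Fin.snoc_castSucc, hsum t] using hL
  · rw [Fin.sum_univ_castSucc]
    simp only [Fin.snoc_castSucc, Fin.snoc_last, hsum t]
    rwa [Finset.sum_insert heL, add_comm] at hx
  · simp only [IPVal, Fin.snoc_castSucc, hsum fun i => (a i : ℤ) - (t i : ℤ),
      Finset.sum_sub_distrib]
    ring

/-- Let `n, r` be positive with `n₁ > n₂`, where `n₁ = ⌈n/(r+1)⌉`,
`n₂ = n₁(r+1) − n`, `μ = n₁ − n₂`, `n₁ = λμ + ν` with `0 ≤ ν < μ`.  Then for every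
`1 ≤ x ≤ n₁`, `Ψ(x) ≤ xr + max{⌈x/(λ+1)⌉, ⌈(x−ν)/λ⌉}`: for every outer-feasible datum
there is an inner-feasible datum whose objective value is at most this quantity. -/
theorem Psi_upper_bound
    {n r n1 n2 mu lam nu : ℕ} (hn : 0 < n) (hr : 0 < r)
    (hn1 : n1 = (n + r) / (r + 1)) (hn2 : n2 = n1 * (r + 1) - n)
    (h12 : n2 < n1) (hmu : mu = n1 - n2)
    (hlamnu : n1 = lam * mu + nu) (hnu : nu < mu) :
    ∀ x : ℕ, 1 ≤ x → x ≤ n1 →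
      ∀ (s : ℕ) (t a : Fin s → ℕ), OuterFeas n1 n2 s t a →
        ∃ (l : ℕ) (h : Fin (l + 1) → Fin s), InnerFeas t x l h ∧
          IPVal t a x r l h ≤
            (x : ℤ) * r + max ⌈(x : ℚ) / ((lam : ℚ) + 1)⌉
              ⌈((x : ℚ) - (nu : ℚ)) / (lam : ℚ)⌉ := by
  rintro x hx1 hxn s t a ⟨-, -, htsum, hasum, hta⟩
  have hlam : 1 ≤ lam := by
    rcases Nat.eq_zero_or_pos lam with h | h
    · subst h
      omega
    · exact h
  have hlamQ : (0 : ℚ) < lam := by exact_mod_cast hlam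
  have hlamQ' : (0 : ℚ) < (lam : ℚ) + 1 := by positivity
  have hxQ : (x : ℚ) ≤ lam * mu + nu := by exact_mod_cast hlamnu ▸ hxn
  have hnuQ : (nu : ℚ) ≤ mu := by exact_mod_cast hnu.le
  set M : ℤ := max ⌈(x : ℚ) / ((lam : ℚ) + 1)⌉ ⌈((x : ℚ) - (nu : ℚ)) / (lam : ℚ)⌉ with hM
  have hM1 : 1 ≤ M := by
    refine le_max_of_le_left (Int.one_le_ceil_iff.mpr ?_)
    have : (0 : ℚ) < x := by exact_mod_cast hx1
    positivity
  have hMmu : M ≤ (mu : ℤ) := by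
    refine max_le (Int.ceil_le.mpr ?_) (Int.ceil_le.mpr ?_)
    · rw [div_le_iff₀ hlamQ']
      push_cast
      linarith
    · rw [div_le_iff₀ hlamQ]
      push_cast
      linarith
  obtain ⟨m, hm⟩ := Int.eq_ofNat_of_zero_le (zero_le_one.trans hM1)
  have hxm : x ≤ m * (lam + 1) := by
    have := Int.ceil_le.mp (hM ▸ le_max_left _ _ : ⌈(x : ℚ) / ((lam : ℚ) + 1)⌉ ≤ M)
    rw [div_le_iff₀ hlamQ', hm] at this
    exact_mod_cast this
  have hxm' : x ≤ nu + lam * m := by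
    have := Int.ceil_le.mp
      (hM ▸ le_max_right _ _ : ⌈((x : ℚ) - (nu : ℚ)) / (lam : ℚ)⌉ ≤ M)
    rw [div_le_iff₀ hlamQ, hm, sub_le_iff_le_add', mul_comm] at this
    exact_mod_cast this
  have hdsum : ∑ i, ((t i : ℤ) - (a i : ℤ)) = mu := by
    rw [Finset.sum_sub_distrib, ← Nat.cast_sum, ← Nat.cast_sum, htsum, hasum]
    omega
  obtain ⟨L, e, heL, hLx, hxL, hLd⟩ := exists_crossing_of_deficiency_lt t
    (fun i => (t i : ℤ) - (a i : ℤ)) (fun i => by have := hta i; omega) hdsum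
    (htsum.trans hlamnu) (by omega) (by omega) hx1 hxm hxm'
  obtain ⟨l, h, hfeas, hval⟩ := exists_innerFeas_of_insert t a x r heL hLx hxL
  refine ⟨l, h, hfeas, ?_⟩
  rw [hval, hm]
  linarith [Int.add_one_le_of_lt hLd]
end

section
/- Let r, k, λ, ν be integers with λ ≥ 1, ν ≥ 0, and 1 < r < k. Then max{x ∈ ℤ : x ≥ 1 and x(r−1) + max{⌈x/(λ+1)⌉, ⌈(x−ν)/λ⌉} < k} = min{ ⌈((λ+1)(k−1)+1) / ((λ+1)(r−1)+1)⌉ , ⌈(λ(k−1)+ν+1) / (λ(r−1)+1)⌉ } − 1. (The maximum exists: x = 1 satisfies the condition since r < k, and the set is bounded above.) -/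
theorem mul_add_ceil_div_lt_iff {r k d n : ℤ} (hd : 0 < d) (hr : 1 < r) (x : ℤ) :
    x * (r - 1) + ⌈((x : ℚ) - n) / d⌉ < k ↔
      x < ⌈((d : ℚ) * (k - 1) + n + 1) / (d * (r - 1) + 1)⌉ := by
  have hd' : (0 : ℚ) < d := by exact_mod_cast hd
  have hD : (0 : ℚ) < d * (r - 1) + 1 := by
    have : (1 : ℚ) < r := by exact_mod_cast hr
    have := mul_pos hd' (sub_pos.2 this)
    linarith
  have hceil : x * (r - 1) + ⌈((x : ℚ) - n) / d⌉ < k ↔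
      ⌈((x : ℚ) - n) / d⌉ ≤ k - 1 - x * (r - 1) := by omega
  rw [hceil, Int.ceil_le, div_le_iff₀ hd', Int.lt_ceil, lt_div_iff₀ hD]
  norm_cast
  constructor <;> intro h <;> linarith

/-- For integers `r, k, λ, ν` with `λ ≥ 1`, `ν ≥ 0` and `1 < r < k`,
`max{x ∈ ℤ : x ≥ 1 ∧ x(r−1) + max{⌈x/(λ+1)⌉, ⌈(x−ν)/λ⌉} < k}`
equals
`min{⌈((λ+1)(k−1)+1)/((λ+1)(r−1)+1)⌉, ⌈(λ(k−1)+ν+1)/(λ(r−1)+1)⌉} − 1`. -/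
theorem eta_formula (r k lam nu : ℤ)
    (hlam : 1 ≤ lam) (hnu : 0 ≤ nu) (hr : 1 < r) (hk : r < k) :
    IsGreatest
      {x : ℤ | 1 ≤ x ∧
        x * (r - 1) + max ⌈(x : ℚ) / ((lam : ℚ) + 1)⌉ ⌈((x : ℚ) - (nu : ℚ)) / (lam : ℚ)⌉ < k}
      (min ⌈(((lam : ℚ) + 1) * ((k : ℚ) - 1) + 1) / (((lam : ℚ) + 1) * ((r : ℚ) - 1) + 1)⌉
           ⌈((lam : ℚ) * ((k : ℚ) - 1) + (nu : ℚ) + 1) / ((lam : ℚ) * ((r : ℚ) - 1) + 1)⌉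
        - 1) := by
  have hmem (x : ℤ) :
      x * (r - 1) + max ⌈(x : ℚ) / ((lam : ℚ) + 1)⌉ ⌈((x : ℚ) - (nu : ℚ)) / (lam : ℚ)⌉ < k ↔
        x < min
          ⌈(((lam : ℚ) + 1) * ((k : ℚ) - 1) + 1) / (((lam : ℚ) + 1) * ((r : ℚ) - 1) + 1)⌉
          ⌈((lam : ℚ) * ((k : ℚ) - 1) + (nu : ℚ) + 1) / ((lam : ℚ) * ((r : ℚ) - 1) + 1)⌉ := by
    have h₁ := mul_add_ceil_div_lt_iff (k := k) (d := lam + 1) (n := 0) (by omega) hr x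
    have h₂ := mul_add_ceil_div_lt_iff (k := k) (n := nu) (show 0 < lam by omega) hr x
    push_cast at h₁
    rw [sub_zero, add_zero] at h₁
    rw [← max_add_add_left, max_lt_iff, lt_min_iff, h₁, h₂]
  have hlam' : (0 : ℚ) < lam := by exact_mod_cast hlam
  have hnu' : (0 : ℚ) ≤ nu := by exact_mod_cast hnu
  have hone : (1 : ℤ) * (r - 1) +
      max ⌈((1 : ℤ) : ℚ) / ((lam : ℚ) + 1)⌉ ⌈(((1 : ℤ) : ℚ) - (nu : ℚ)) / (lam : ℚ)⌉ < k := by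
    have h₁ : ⌈((1 : ℤ) : ℚ) / ((lam : ℚ) + 1)⌉ ≤ 1 := by
      rw [Int.ceil_le, div_le_iff₀ (by linarith)]
      push_cast
      linarith
    have h₂ : ⌈(((1 : ℤ) : ℚ) - (nu : ℚ)) / (lam : ℚ)⌉ ≤ 1 := by
      have : (1 : ℚ) ≤ lam := by exact_mod_cast hlam
      rw [Int.ceil_le, div_le_iff₀ hlam']
      push_cast
      linarith
    have := max_le h₁ h₂
    omega
  have hlt := (hmem 1).1 hone
  exact ⟨⟨Int.le_sub_one_of_lt hlt, (hmem _).2 (Int.sub_one_lt_of_le le_rfl)⟩,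
    fun x hx => Int.le_sub_one_of_lt ((hmem x).1 hx.2)⟩
end

section
/- Let n and r be positive integers with n_1 > n_2. Define integers e_{n_1}, e_{n_1−1}, …, e_1 by e_{n_1} = n and e_{m−1} = e_m − ⌈2e_m/m⌉ + (r+1) for 2 ≤ m ≤ n_1. Then e_m ≥ Ψ(m) for every integer m with 1 ≤ m ≤ n_1. -/
open Finset

/-- With `e = m * (r + 1) - f` and `0 ≤ f < m`, one step of the recursion decreases the defect `f`
by one exactly when `m ≤ 2 * f`. -/
lemma ceil_two_mul_div_of_defect {m : ℕ} {r f e : ℤ} (hm : 0 < m) (hf : 0 ≤ f) (hfm : f < m)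
    (he : e = m * (r + 1) - f) :
    ⌈(2 * (e : ℚ)) / (m : ℚ)⌉ = 2 * (r + 1) - if (m : ℤ) ≤ 2 * f then 1 else 0 := by
  have hmq : (0 : ℚ) < m := by exact_mod_cast hm
  have hf' : (0 : ℚ) ≤ f := by exact_mod_cast hf
  have hfm' : (f : ℚ) < m := by exact_mod_cast hfm
  rw [Int.ceil_eq_iff, lt_div_iff₀ hmq, div_le_iff₀ hmq, he]
  split_ifs with h
  · have h' : (m : ℚ) ≤ 2 * f := by exact_mod_cast h
    push_cast
    constructor <;> nlinarith
  · have h' : 2 * (f : ℚ) < m := by exact_mod_cast not_le.mp h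
    push_cast
    constructor <;> nlinarith

/-- If `1 ≤ x ≤ ∑ i ∈ N, t i`, then some element `p` of `N` completes a subset of `N` of total
weight less than `x` to one of total weight at least `x`. -/
lemma exists_subset_sum_lt_le {ι : Type*} [DecidableEq ι] (t : ι → ℕ) {x : ℕ} (hx : 1 ≤ x)
    (N : Finset ι) (hN : x ≤ ∑ i ∈ N, t i) :
    ∃ S ⊆ N, ∃ p ∉ S, ∑ i ∈ S, t i < x ∧ x ≤ ∑ i ∈ S, t i + t p := by
  induction N using Finset.induction_on with
  | empty => simp at hN; omega
  | insert p N hp ih =>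
    by_cases h : x ≤ ∑ i ∈ N, t i
    · obtain ⟨S, hS, hrest⟩ := ih h
      exact ⟨S, hS.trans (Finset.subset_insert _ _), hrest⟩
    · rw [Finset.sum_insert hp] at hN
      exact ⟨N, Finset.subset_insert _ _, p, hp, by omega, by omega⟩

/-- A set `S` of indices and a further index `p`, enumerated, form an inner-feasible datum. -/
lemma exists_innerFeas_of_finset {s : ℕ} (t a : Fin s → ℕ) (x r : ℕ) (S : Finset (Fin s))
    (p : Fin s) (hp : p ∉ S) (hlt : ∑ i ∈ S, t i < x) (hle : x ≤ ∑ i ∈ S, t i + t p) :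
    ∃ (l : ℕ) (h : Fin (l + 1) → Fin s), InnerFeas t x l h ∧
      IPVal t a x r l h = (x : ℤ) * r + 1 - ∑ i ∈ S, ((a i : ℤ) - t i) := by
  have hsum : ∀ {M : Type} [AddCommMonoid M] (g : Fin s → M),
      ∑ i, g (S.orderEmbOfFin rfl i) = ∑ i ∈ S, g i := by
    intro M _ g
    conv_rhs => rw [← Finset.map_orderEmbOfFin_univ S rfl, Finset.sum_map]
    rfl
  refine ⟨S.card, Fin.snoc (α := fun _ => Fin s) (S.orderEmbOfFin rfl) p, ⟨?_, ?_, ?_⟩, ?_⟩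
  · rw [Fin.snoc_injective_iff]
    refine ⟨(S.orderEmbOfFin rfl).injective, ?_⟩
    simpa using hp
  · simpa only [Fin.snoc_castSucc, hsum t] using hlt
  · rw [Fin.sum_univ_castSucc]
    simpa only [Fin.snoc_castSucc, Fin.snoc_last, hsum t] using hle
  · simp only [IPVal, Fin.snoc_castSucc]
    rw [hsum (fun i => (a i : ℤ) - t i)]

/-- The indices in `S` together with `p` are an initial segment, of total weight just reaching `m`,
of an ordering in which the indices with `t i ≤ a i` come first and the remaining ones follow by
decreasing `t i`, and the corresponding objective value is compatible with the defect `f`. -/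
def GreedySegment {ι : Type*} (t a : ι → ℕ) (m : ℕ) (f : ℤ) (S : Finset ι) (p : ι) : Prop :=
  p ∉ S ∧ (∀ i, t i ≤ a i → i ∈ S) ∧ (∀ q ∈ S, t q ≤ a q ∨ t p ≤ t q) ∧
    ∑ i ∈ S, t i < m ∧ m ≤ ∑ i ∈ S, t i + t p ∧ f ≤ m - 1 + ∑ i ∈ S, ((a i : ℤ) - t i)

/-- A set containing an index `q` with `a q < t q` contains a last element in the greedy order. -/
lemma exists_min_deficient {ι : Type*} (t a : ι → ℕ) (S : Finset ι)
    (h : ∃ q ∈ S, a q < t q) :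
    ∃ p ∈ S, a p < t p ∧ ∀ q ∈ S, t q ≤ a q ∨ t p ≤ t q := by
  classical
  obtain ⟨q, hq, hqt⟩ := h
  obtain ⟨p, hp, hmin⟩ := Finset.exists_min_image (S.filter fun i => a i < t i) t
    ⟨q, by simp [hq, hqt]⟩
  simp only [Finset.mem_filter] at hp hmin
  refine ⟨p, hp.1, hp.2, fun i hi => ?_⟩
  by_cases hia : a i < t i
  · exact Or.inr (hmin i ⟨hi, hia⟩)
  · exact Or.inl (not_lt.mp hia)

/-- Removing one unit from a greedy segment yields either a greedy segment for the updated defect,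
or a size that is covered by the indices with `t i ≤ a i` alone. -/
lemma GreedySegment.pred {ι : Type*} [Fintype ι] [DecidableEq ι] {t a : ι → ℕ}
    (hta : ∀ i, t i ≤ a i + 1) (ht : ∀ i, 1 ≤ t i) {m : ℕ} {f f' : ℤ} {S : Finset ι} {p : ι}
    (hG : GreedySegment t a (m + 1) f S p)
    (hf' : f' = f - if ((m + 1 : ℕ) : ℤ) ≤ 2 * f then 1 else 0) :
    m ≤ ∑ i with t i ≤ a i, t i ∨ ∃ S p, GreedySegment t a m f' S p := by
  obtain ⟨hp, hN, hmin, hlt, hle, hf⟩ := hG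
  by_cases hm : ∑ i ∈ S, t i < m
  · refine Or.inr ⟨S, p, hp, hN, hmin, hm, by omega, ?_⟩
    have h2 : ∑ i ∈ S, (t i : ℤ) ≤ ∑ i ∈ S, 2 * (a i : ℤ) := by
      refine Finset.sum_le_sum fun q hq => ?_
      have := hmin q hq
      have := hta q
      have := ht q
      omega
    rw [← Finset.mul_sum] at h2
    rw [Finset.sum_sub_distrib] at hf ⊢
    have hmz : ∑ i ∈ S, (t i : ℤ) < m := by exact_mod_cast hm
    push_cast at *
    split_ifs at hf' <;> omega
  · have hmS : ∑ i ∈ S, t i = m := by omega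
    by_cases hS : ∃ q ∈ S, a q < t q
    · obtain ⟨q, hq, hqt, hqmin⟩ := exists_min_deficient t a S hS
      have hst := Finset.sum_erase_add S t hq
      have hsa := Finset.sum_erase_add S (fun i => (a i : ℤ) - t i) hq
      have h1 := ht q
      have h2 := hta q
      refine Or.inr ⟨S.erase q, q, Finset.notMem_erase q S, fun i hi => ?_, fun i hi =>
        hqmin i (Finset.mem_of_mem_erase hi), by omega, by omega, ?_⟩
      · refine Finset.mem_erase.mpr ⟨?_, hN i hi⟩
        rintro rfl
        omega
      · push_cast at *
        split_ifs at hf' <;> omega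
    · push Not at hS
      refine Or.inl ?_
      rw [← hmS]
      exact Finset.sum_le_sum_of_subset fun i hi => by simp [hS i hi]

/-- If the total of `a` is less than that of `t`, the full index set is a greedy segment. -/
lemma exists_greedySegment_univ {ι : Type*} [Fintype ι] [DecidableEq ι] {t a : ι → ℕ}
    (hta : ∀ i, t i ≤ a i + 1) (ht : ∀ i, 1 ≤ t i) (hlt : ∑ i, a i < ∑ i, t i) :
    ∃ S p, GreedySegment t a (∑ i, t i) (∑ i, a i : ℕ) S p := by
  have hex : ∃ q ∈ (Finset.univ : Finset ι), a q < t q := Finset.exists_lt_of_sum_lt hlt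
  obtain ⟨q, hq, hqt, hqmin⟩ := exists_min_deficient t a _ hex
  have hst := Finset.sum_erase_add _ t hq
  have hsa := Finset.sum_erase_add _ (fun i => (a i : ℤ) - t i) hq
  have h1 := ht q
  have h2 := hta q
  refine ⟨Finset.univ.erase q, q, Finset.notMem_erase q _, fun i hi => ?_, fun i hi =>
    hqmin i (Finset.mem_of_mem_erase hi), by omega, by omega, ?_⟩
  · refine Finset.mem_erase.mpr ⟨?_, Finset.mem_univ i⟩
    rintro rfl
    omega
  · rw [Finset.sum_sub_distrib (s := Finset.univ)] at hsa
    push_cast at *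
    omega

/-- Let `n, r` be positive with `n₁ > n₂` (`n₁ = ⌈n/(r+1)⌉`,
`n₂ = n₁(r+1) − n`), and let `e` satisfy `e n₁ = n` and
`e (m−1) = e m − ⌈2·(e m)/m⌉ + (r+1)` for `2 ≤ m ≤ n₁`.  Then `e m ≥ Ψ(m)` for all
`1 ≤ m ≤ n₁`: for every outer-feasible datum there is an inner-feasible datum whose
objective value is at most `e m`. -/
theorem prakash_sequence_dominates_Psi
    {n r n1 n2 : ℕ} (hn : 0 < n) (hr : 0 < r)
    (hn1 : n1 = (n + r) / (r + 1)) (hn2 : n2 = n1 * (r + 1) - n) (h12 : n2 < n1)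
    (e : ℕ → ℤ) (he : e n1 = (n : ℤ))
    (hrec : ∀ m : ℕ, 2 ≤ m → m ≤ n1 →
      e (m - 1) = e m - ⌈(2 * (e m : ℚ)) / (m : ℚ)⌉ + (r + 1)) :
    ∀ m : ℕ, 1 ≤ m → m ≤ n1 →
      ∀ (s : ℕ) (t a : Fin s → ℕ), OuterFeas n1 n2 s t a →
        ∃ (l : ℕ) (h : Fin (l + 1) → Fin s), InnerFeas t m l h ∧
          IPVal t a m r l h ≤ e m := by
  intro m hm1 hmn s t a ⟨_, ht, hst, hsa, hta⟩
  have hle : n ≤ n1 * (r + 1) := by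
    have h := Nat.lt_div_mul_add (a := n + r) (b := r + 1) (by omega)
    rw [← hn1] at h
    omega
  have hn2' : (n2 : ℤ) = n1 * (r + 1) - n := by
    rw [hn2, Nat.cast_sub hle]
    push_cast
    ring
  have key : ∃ f : ℤ, e m = m * (r + 1) - f ∧ 0 ≤ f ∧ f < m ∧
      (m ≤ ∑ i with t i ≤ a i, t i ∨ ∃ S p, GreedySegment t a m f S p) := by
    induction hmn using Nat.decreasingInduction with
    | self =>
      refine ⟨n2, by rw [he, hn2']; ring, by omega, by omega, Or.inr ?_⟩
      have := exists_greedySegment_univ hta ht (by omega)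
      rwa [hst, hsa] at this
    | of_succ m hmn ih =>
      obtain ⟨f, hef, hf0, hfm, hG⟩ := ih (by omega)
      have hceil := ceil_two_mul_div_of_defect (Nat.succ_pos m) hf0 hfm hef
      have hstep := hrec (m + 1) (by omega) hmn
      rw [Nat.succ_eq_add_one] at hceil
      rw [hceil, Nat.add_sub_cancel] at hstep
      refine ⟨f - if ((m + 1 : ℕ) : ℤ) ≤ 2 * f then 1 else 0, ?_, ?_, ?_, ?_⟩
      · rw [hstep, hef]
        push_cast
        ring
      · split_ifs <;> push_cast at * <;> omega
      · split_ifs <;> push_cast at * <;> omega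
      · rcases hG with hG | ⟨S, p, hG⟩
        · exact Or.inl (by omega)
        · exact hG.pred hta ht rfl
  obtain ⟨f, hef, -, hfm, hN | ⟨S, p, hp, -, -, hlt, hle', hf⟩⟩ := key
  · obtain ⟨S, hS, p, hp, hlt, hle'⟩ := exists_subset_sum_lt_le t hm1 _ hN
    obtain ⟨l, h, hfeas, hval⟩ := exists_innerFeas_of_finset t a m r S p hp hlt hle'
    refine ⟨l, h, hfeas, ?_⟩
    have hnonneg : 0 ≤ ∑ i ∈ S, ((a i : ℤ) - t i) :=
      Finset.sum_nonneg fun i hi => by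
        have := (Finset.mem_filter.mp (hS hi)).2
        omega
    rw [hval, hef, mul_add]
    omega
  · obtain ⟨l, h, hfeas, hval⟩ := exists_innerFeas_of_finset t a m r S p hp hlt hle'
    refine ⟨l, h, hfeas, ?_⟩
    rw [hval, hef, mul_add]
    omega
end

section
/- Let r, k, λ, μ, ν be integers with r ≥ 2, k > r, λ ≥ 1, and 0 ≤ ν < μ. Let Ω be a finite set written as a disjoint union Ω = U_1 ∪ ⋯ ∪ U_μ, where for each l ∈ [μ], U_l = ∪_i W^{(l)}_i with i ranging over [λ+1] if l ≤ ν and over [λ] if l > ν, every |W^{(l)}_i| = r+1, and for each l there is a common element ω^{(l)}_0 with W^{(l)}_i ∩ W^{(l)}_{i'} = {ω^{(l)}_0} whenever i ≠ i'. Then for every subset V ⊆ Ω with |V| = k + η̃ there exist subsets V_1, …, V_μ of V such that: (1) |V_1 ∪ ⋯ ∪ V_μ| ≥ k; and (2) for each l ∈ [μ], V_l ⊆ U_l, and if V_l is nonempty there exists ω_l ∈ V_l with |(V_l ∖ {ω_l}) ∩ W^{(l)}_i| ≤ r − 1 for every admissible index i. -/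
open Finset

/-- Deleting a transversal of the branches that are full away from the root leaves at most
`r - 1` non-root points in every branch. -/
lemma exists_transversal_of_full_branches {α : Type*} [DecidableEq α] (r b : ℕ) (hr : 2 ≤ r)
    (W : ℕ → Finset α) (ω : α) (hcard : ∀ i < b, (W i).card = r + 1) (hω : ∀ i < b, ω ∈ W i)
    (hroot : ∀ i < b, ∀ j < b, i ≠ j → W i ∩ W j = {ω}) (T : Finset α) :
    ∃ n ≤ b, ∃ X ⊆ T.erase ω, X.card ≤ n ∧ (n ≠ 0 → X.Nonempty) ∧ r * n ≤ (T.erase ω).card ∧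
      ∀ i < b, ((T.erase ω \ X) ∩ W i).card ≤ r - 1 := by
  set F := (range b).filter fun i => r ≤ (T.erase ω ∩ W i).card with hF
  have hne : ∀ i ∈ F, (T.erase ω ∩ W i).Nonempty := fun i hi =>
    card_pos.1 (by have := (mem_filter.1 hi).2; omega)
  have : Nonempty α := ⟨ω⟩
  choose! x hx using hne
  refine ⟨F.card, (card_filter_le _ _).trans (card_range b).le, F.image x, ?_, card_image_le,
    fun h => (card_ne_zero.1 h).image x, ?_, ?_⟩
  · exact image_subset_iff.2 fun i hi => (mem_inter.1 (hx i hi)).1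
  · have hd : (F : Set ℕ).PairwiseDisjoint fun i => T.erase ω ∩ W i := by
      intro i hi j hj hij
      have hi' := mem_range.1 (mem_filter.1 (mem_coe.1 hi)).1
      have hj' := mem_range.1 (mem_filter.1 (mem_coe.1 hj)).1
      refine disjoint_left.2 fun a ha ha' => ?_
      have h : a ∈ W i ∩ W j := mem_inter.2 ⟨(mem_inter.1 ha).2, (mem_inter.1 ha').2⟩
      rw [hroot i hi' j hj' hij, mem_singleton] at h
      exact (mem_erase.1 (mem_inter.1 ha).1).1 h
    calc r * F.card = ∑ _i ∈ F, r := by rw [sum_const, smul_eq_mul, mul_comm]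
      _ ≤ ∑ i ∈ F, (T.erase ω ∩ W i).card := sum_le_sum fun i hi => (mem_filter.1 hi).2
      _ = (F.biUnion fun i => T.erase ω ∩ W i).card := (card_biUnion hd).symm
      _ ≤ _ := card_le_card (biUnion_subset.2 fun i _ => inter_subset_left)
  · intro i hi
    by_cases hiF : i ∈ F
    · have hxi := hx i hiF
      have hsub : (T.erase ω \ F.image x) ∩ W i ⊆ ((W i).erase ω).erase (x i) := by
        intro a ha
        simp only [mem_inter, mem_sdiff, mem_erase, mem_image] at ha ⊢
        exact ⟨fun h => ha.1.2 ⟨i, hiF, h.symm⟩, ha.1.1.1, ha.2⟩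
      refine (card_le_card hsub).trans ?_
      have hmem : x i ∈ (W i).erase ω :=
        mem_erase.2 ⟨(mem_erase.1 (mem_inter.1 hxi).1).1, (mem_inter.1 hxi).2⟩
      rw [card_erase_of_mem hmem, card_erase_of_mem (hω i hi), hcard i hi]
      omega
    · have hlt : (T.erase ω ∩ W i).card < r := by
        by_contra! h
        exact hiF (mem_filter.2 ⟨mem_range.2 hi, h⟩)
      have := card_le_card (inter_subset_inter_right (u := W i)
        (sdiff_subset (s := T.erase ω) (t := F.image x)))
      omega

/-- In a single tree with `b` branches, a set `T` contains an admissible subset `S` missing at most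
`n ≤ b` points, where `T` has at least `r * n + 1` points unless `n = 0`. -/
lemma exists_admissible_subset {α : Type*} [DecidableEq α] (r b : ℕ) (hr : 2 ≤ r)
    (W : ℕ → Finset α) (ω : α) (hcard : ∀ i < b, (W i).card = r + 1) (hω : ∀ i < b, ω ∈ W i)
    (hroot : ∀ i < b, ∀ j < b, i ≠ j → W i ∩ W j = {ω}) (T : Finset α) :
    ∃ S ⊆ T, ∃ n ≤ b, T.card ≤ S.card + n ∧ (n ≠ 0 → r * n + 1 ≤ T.card) ∧
      (S.Nonempty → ∃ a ∈ S, ∀ i < b, (S.erase a ∩ W i).card ≤ r - 1) := by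
  obtain ⟨n, hn, X, hXT, hXn, hXne, hnT, hX⟩ :=
    exists_transversal_of_full_branches r b hr W ω hcard hω hroot T
  have hsd := card_sdiff_add_card_eq_card hXT
  have hsub : T.erase ω \ X ⊆ T := sdiff_subset.trans (erase_subset ω T)
  by_cases hT : ω ∈ T
  · have hT' := card_erase_add_one hT
    have hnot : ω ∉ T.erase ω \ X := fun h => notMem_erase ω T (mem_sdiff.1 h).1
    refine ⟨insert ω (T.erase ω \ X), insert_subset hT hsub, n, hn, ?_, by omega,
      fun _ => ⟨ω, mem_insert_self _ _, ?_⟩⟩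
    · rw [card_insert_of_notMem hnot]
      omega
    · rwa [erase_insert hnot]
  · rw [erase_eq_of_notMem hT] at hXT hnT hX hsd hsub
    rcases Nat.eq_zero_or_pos n with h0 | hpos
    · have hX0 : X = ∅ := card_eq_zero.1 (by omega)
      rw [hX0, sdiff_empty] at hX
      refine ⟨T, Subset.rfl, 0, Nat.zero_le _, le_rfl, fun h => absurd rfl h, ?_⟩
      rintro ⟨a, ha⟩
      exact ⟨a, ha, fun i hi =>
        (card_le_card (inter_subset_inter_right (erase_subset a T))).trans (hX i hi)⟩
    · obtain ⟨a, ha⟩ := hXne hpos.ne'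
      have hnot : a ∉ T \ X := fun h => (mem_sdiff.1 h).2 ha
      refine ⟨insert a (T \ X), insert_subset (hXT ha) hsub, n - 1, by omega, ?_, ?_,
        fun _ => ⟨a, mem_insert_self _ _, ?_⟩⟩
      · rw [card_insert_of_notMem hnot]
        omega
      · intro _
        obtain ⟨m, rfl⟩ := Nat.exists_eq_add_of_lt hpos
        simp only [zero_add, Nat.add_sub_cancel] at hnT ⊢
        rw [mul_add] at hnT
        omega
      · rwa [erase_insert hnot]

/-- The pigeonhole estimate on the total loss: if `t` trees lose `L` points in total, and these trees
contain at least `r * L + t` points, then `L` does not exceed the excess of `N` over `k`. -/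
lemma add_le_of_mul_add_le (r k lam nu N L t : ℕ) (hr : 2 ≤ r)
    (h₁ : L ≤ (lam + 1) * t) (h₂ : L ≤ lam * t + nu) (hN : r * L + t ≤ N)
    (hNk : (N : ℤ) = (k : ℤ) +
      (min ⌈(((lam : ℚ) + 1) * ((k : ℚ) - 1) + 1) / (((lam : ℚ) + 1) * ((r : ℚ) - 1) + 1)⌉
           ⌈((lam : ℚ) * ((k : ℚ) - 1) + (nu : ℚ) + 1) / ((lam : ℚ) * ((r : ℚ) - 1) + 1)⌉
        - 1)) :
    k + L ≤ N := by
  by_contra! hlt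
  have hr' : (0 : ℚ) ≤ (r : ℚ) - 1 := by
    have : (2 : ℚ) ≤ r := by exact_mod_cast hr
    linarith
  have hlam : (0 : ℚ) ≤ lam := Nat.cast_nonneg lam
  have h₁' : (L : ℚ) ≤ (lam + 1) * t := by exact_mod_cast h₁
  have h₂' : (L : ℚ) ≤ lam * t + nu := by exact_mod_cast h₂
  have hk : ((r : ℚ) - 1) * L + t ≤ k - 1 := by
    have h : (r : ℚ) * L + t ≤ N := by exact_mod_cast hN
    have h' : (N : ℚ) + 1 ≤ k + L := by exact_mod_cast hlt
    linarith
  have hmin : min ⌈(((lam : ℚ) + 1) * ((k : ℚ) - 1) + 1) / (((lam : ℚ) + 1) * ((r : ℚ) - 1) + 1)⌉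
      ⌈((lam : ℚ) * ((k : ℚ) - 1) + (nu : ℚ) + 1) / ((lam : ℚ) * ((r : ℚ) - 1) + 1)⌉ ≤ (L : ℤ) := by
    omega
  rcases min_le_iff.1 hmin with h | h
  · rw [Int.ceil_le, div_le_iff₀ (by positivity), Int.cast_natCast] at h
    have := mul_le_mul_of_nonneg_left hk (by positivity : (0 : ℚ) ≤ lam + 1)
    linarith
  · rw [Int.ceil_le, div_le_iff₀ (by positivity), Int.cast_natCast] at h
    have := mul_le_mul_of_nonneg_left hk hlam
    linarith

/-- Let `r ≥ 2`, `k > r`, `λ ≥ 1`, `0 ≤ ν < μ`, and let `Ω` be the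
disjoint union of sets `U_l = ∪_i W^{(l)}_i` (`l ∈ [μ]`, with `i` ranging over `λ+1`
branches if `l ≤ ν` and over `λ` branches otherwise, encoded by the branch count `b`),
where each `|W^{(l)}_i| = r+1` and distinct branches of the same tree meet exactly in a
common root `{ω^{(l)}_0}`.  Then every `V ⊆ Ω` with `|V| = k + η̃` admits subsets
`V_1,…,V_μ ⊆ V` with `|V_1 ∪ ⋯ ∪ V_μ| ≥ k` such that for each `l`, `V_l ⊆ U_l` and, if
`V_l ≠ ∅`, some `ω_l ∈ V_l` satisfies `|(V_l ∖ {ω_l}) ∩ W^{(l)}_i| ≤ r − 1` for every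
admissible branch `i`.  Here
`η̃ = min{⌈((λ+1)(k−1)+1)/((λ+1)(r−1)+1)⌉, ⌈(λ(k−1)+ν+1)/(λ(r−1)+1)⌉} − 1`. -/
theorem tree_selection_claim
    {α : Type*} [DecidableEq α]
    (r k lam mu nu : ℕ) (hr : 2 ≤ r) (hk : r < k) (hlam : 1 ≤ lam) (hnumu : nu < mu)
    (b : Fin mu → ℕ) (hb : ∀ l : Fin mu, b l = if (l : ℕ) < nu then lam + 1 else lam)
    (W : Fin mu → ℕ → Finset α) (ω0 : Fin mu → α)
    (hcard : ∀ l : Fin mu, ∀ i < b l, (W l i).card = r + 1)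
    (hroot : ∀ l : Fin mu, ∀ i < b l, ∀ i' < b l, i ≠ i' → W l i ∩ W l i' = {ω0 l})
    (hdisj : ∀ l l' : Fin mu, l ≠ l' →
      Disjoint ((Finset.range (b l)).biUnion (W l))
               ((Finset.range (b l')).biUnion (W l')))
    (V : Finset α)
    (hVsub : V ⊆ Finset.univ.biUnion (fun l => (Finset.range (b l)).biUnion (W l)))
    (hVcard : (V.card : ℤ) = (k : ℤ) +
      (min ⌈(((lam : ℚ) + 1) * ((k : ℚ) - 1) + 1) / (((lam : ℚ) + 1) * ((r : ℚ) - 1) + 1)⌉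
           ⌈((lam : ℚ) * ((k : ℚ) - 1) + (nu : ℚ) + 1) / ((lam : ℚ) * ((r : ℚ) - 1) + 1)⌉
        - 1)) :
    ∃ Vs : Fin mu → Finset α,
      (∀ l, Vs l ⊆ V ∧ Vs l ⊆ (Finset.range (b l)).biUnion (W l)) ∧
      k ≤ (Finset.univ.biUnion Vs).card ∧
      ∀ l, (Vs l).Nonempty → ∃ ω ∈ Vs l, ∀ i < b l,
        (((Vs l).erase ω) ∩ W l i).card ≤ r - 1 := by
  have hb1 : ∀ l, 1 ≤ b l := fun l => by rw [hb]; split_ifs <;> omega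
  have hroot' : ∀ l, ∃ ω, (∀ i < b l, ω ∈ W l i) ∧
      ∀ i < b l, ∀ j < b l, i ≠ j → W l i ∩ W l j = {ω} := by
    intro l
    rcases (hb1 l).eq_or_lt with h | h
    · obtain ⟨a, ha⟩ : (W l 0).Nonempty := card_pos.1 (by rw [hcard l 0 (by omega)]; omega)
      refine ⟨a, fun i hi => ?_, fun i hi j hj hij => by omega⟩
      obtain rfl : i = 0 := by omega
      exact ha
    · refine ⟨ω0 l, fun i hi => ?_, hroot l⟩
      obtain ⟨j, hj, hij⟩ : ∃ j < b l, i ≠ j := by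
        by_cases h0 : i = 0
        · exact ⟨1, h, by omega⟩
        · exact ⟨0, by omega, h0⟩
      have hmem : ω0 l ∈ W l i ∩ W l j := by
        rw [hroot l i hi j hj hij]
        exact mem_singleton_self _
      exact (mem_inter.1 hmem).1
  choose ω hω hωroot using hroot'
  set U : Fin mu → Finset α := fun l => (range (b l)).biUnion (W l) with hU
  choose S hST n hnb hTS hnT hS using fun l =>
    exists_admissible_subset r (b l) hr (W l) (ω l) (hcard l) (hω l) (hωroot l) (V ∩ U l)
  have hV : V.card = ∑ l, (V ∩ U l).card := by
    rw [← card_biUnion fun l _ l' _ hl =>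
      (hdisj l l' hl).mono inter_subset_right inter_subset_right, ← inter_biUnion,
      inter_eq_left.2 hVsub]
  have hScard : (univ.biUnion S).card = ∑ l, (S l).card :=
    card_biUnion fun l _ l' _ hl => (hdisj l l' hl).mono
      ((hST l).trans inter_subset_right) ((hST l').trans inter_subset_right)
  refine ⟨S, fun l => ⟨(hST l).trans inter_subset_left, (hST l).trans inter_subset_right⟩, ?_, hS⟩
  set P := univ.filter fun l => n l ≠ 0 with hP
  have hL : ∑ l ∈ P, n l = ∑ l, n l := sum_filter_ne_zero univ
  have h₁ : ∑ l, n l ≤ (lam + 1) * P.card := by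
    rw [← hL, mul_comm, ← smul_eq_mul]
    refine sum_le_card_nsmul _ _ _ fun l _ => (hnb l).trans ?_
    rw [hb]
    split_ifs <;> omega
  have h₂ : ∑ l, n l ≤ lam * P.card + nu := by
    rw [← hL]
    have hnu : (univ.filter fun l : Fin mu => (l : ℕ) < nu).card ≤ nu := by
      rw [Fin.card_filter_val_lt]
      exact min_le_right _ _
    calc ∑ l ∈ P, n l ≤ ∑ l ∈ P, (lam + if (l : ℕ) < nu then 1 else 0) := by
          refine sum_le_sum fun l _ => (hnb l).trans ?_
          rw [hb]
          split_ifs <;> omega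
      _ = lam * P.card + (P.filter fun l : Fin mu => (l : ℕ) < nu).card := by
          rw [sum_add_distrib, sum_const, smul_eq_mul, mul_comm, ← card_filter]
      _ ≤ _ := by
          gcongr
          exact (card_le_card (filter_subset_filter _ (subset_univ P))).trans hnu
  have hN : r * (∑ l, n l) + P.card ≤ V.card := by
    calc r * (∑ l, n l) + P.card = ∑ l ∈ P, (r * n l + 1) := by
          rw [← hL, sum_add_distrib, mul_sum, card_eq_sum_ones]
      _ ≤ ∑ l ∈ P, (V ∩ U l).card := sum_le_sum fun l hl => hnT l (mem_filter.1 hl).2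
      _ ≤ ∑ l, (V ∩ U l).card := sum_le_sum_of_subset (subset_univ P)
      _ = _ := hV.symm
  have hk' := add_le_of_mul_add_le r k lam nu _ _ _ hr h₁ h₂ hN hVcard
  have hloss : V.card ≤ (univ.biUnion S).card + ∑ l, n l := by
    rw [hV, hScard, ← sum_add_distrib]
    exact sum_le_sum fun l _ => hTS l
  omega
end
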